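/- Let O be a W-orbit in ℝ^r, let w ∈ W_0 with reduced expression w = s_{i_1}⋯s_{i_ℓ} (1 ≤ i_1,…,i_ℓ ≤ r), and let λ ∈ ℤ^r. Then x^λ·T_{i_1}(T_{i_2}(⋯(T_{i_ℓ}(x^{c^O}))⋯)) = κ_w^O·x^{λ + wc^O}, where κ_w^O := ∏_{α ∈ Π(w)} 𝐤_α^{χ_e(α(c^O))}·𝐤_{α/2}^{−χ_o(α(c^O))} with Π(w) := {α ∈ Φ_0^+ : wα ∈ −Φ_0^+}, 𝐤_α := k and 𝐤_{α/2} := k for α short, and 𝐤_α := k_r and 𝐤_{α/2} := u_r for α long. In particular the left-hand side does not depend on the chosen reduced expression of w. -/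

import Mathlib

open scoped Classical

noncomputable section

namespace QP

/-! ### The space of quasi-polynomials -/

/-- Euclidean space `ℝ^r`. -/
abbrev E (r : ℕ) := Fin r → ℝ

variable (F : Type*) [Field F] [CharZero F] (r : ℕ)

/-- The algebra of quasi-polynomials `F[ℝ^r]`: the group algebra of `(ℝ^r,+)` over `F`. -/
abbrev QA := AddMonoidAlgebra F (E r)

/-- The quasi-monomial `x^y`. -/
def X (y : E r) : QA F r := AddMonoidAlgebra.single y 1

/-- The `i`-th coordinate of a vector (`1`-based). -/
def cd (y : E r) (i : ℕ) : ℝ := ∑ m : Fin r, if (m : ℕ) + 1 = i then y m else 0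

/-- The standard basis vector `ε_i` (`1`-based). -/
def epsV (i : ℕ) : E r := fun m => if (m : ℕ) + 1 = i then 1 else 0

/-- The standard basis vector (`0`-based). -/
def eV (m : Fin r) : E r := fun n => if n = m then 1 else 0

/-- The Euclidean inner product on `ℝ^r`. -/
def ip (v y : E r) : ℝ := ∑ m : Fin r, v m * y m

/-- An integral vector regarded as an element of `ℝ^r`. -/
def zc (lam : Fin r → ℤ) : E r := fun m => (lam m : ℝ)

/-- The simple reflections of the hyperoctahedral group `W₀ = S_r ⋉ (±1)^r` (`1`-based):
for `1 ≤ i < r`, `sW i` interchanges the `i`-th and `(i+1)`-st coordinates, and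
`sW r` negates the last coordinate. -/
def sW (i : ℕ) (y : E r) : E r := fun m =>
  if i = r then (if (m : ℕ) + 1 = r then -y m else y m)
  else if (m : ℕ) + 1 = i then cd r y (i + 1)
  else if (m : ℕ) = i then cd r y i
  else y m

/-- `s_{ε₁} = s₁⋯s_{r-1} s_r s_{r-1}⋯s₁`: negation of the first coordinate. -/
def sEps1 (y : E r) : E r := fun m => if (m : ℕ) = 0 then -y m else y m

/-- The affine simple reflection `s₀ = τ(ε₁) s_{ε₁} : y ↦ (1 - y₁, y₂, …, y_r)`, together
with `genF j = sW j` for `1 ≤ j ≤ r`: the Coxeter generators of the affine Weyl group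
`W = W₀ ⋉ ℤ^r`. -/
def genF (j : ℕ) (y : E r) : E r :=
  if j = 0 then fun m => if (m : ℕ) = 0 then 1 - y m else y m
  else sW r j y

/-- The action of the word `s_{j₁} ⋯ s_{j_ℓ}` on `ℝ^r`. -/
def wordAct (l : List ℕ) (y : E r) : E r := l.foldr (genF r) y

/-- The closure of the fundamental alcove
`C₊ = {y : 0 < y_r < ⋯ < y₁ < 1/2}`. -/
def CplusCl : Set (E r) :=
  {y | (∀ i j : Fin r, i ≤ j → y j ≤ y i) ∧ ∀ m : Fin r, 0 ≤ y m ∧ y m ≤ 1 / 2}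

/-- The `W`-orbit of a point of `ℝ^r`. -/
def orbit (y : E r) : Set (E r) :=
  {z | ∃ l : List ℕ, (∀ a ∈ l, a ≤ r) ∧ wordAct r l y = z}

/-- `O` is a `W`-orbit in `ℝ^r`. -/
def IsOrbit (O : Set (E r)) : Prop := ∃ y, O = orbit r y

/-- `c^𝒪`: the unique point of the orbit `O` lying in the closed fundamental alcove. -/
def cpt (O : Set (E r)) : E r :=
  if h : ∃ c, c ∈ O ∧ c ∈ CplusCl r then h.choose else 0

/-- The length of an element of the affine Weyl group `W` (as a map on `ℝ^r`). -/
def wlen (g : E r → E r) : ℕ :=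
  sInf {n | ∃ l : List ℕ, (∀ a ∈ l, a ≤ r) ∧ l.length = n ∧ (fun y => wordAct r l y) = g}

/-- A choice of a shortest word `l` whose inverse maps `y` into the closed alcove;
the corresponding element of `W` is `g_y`. -/
def gW (y : E r) : List ℕ :=
  if h : ∃ l : List ℕ, (∀ a ∈ l, a ≤ r) ∧ wordAct r l.reverse y ∈ CplusCl r ∧
      ∀ l' : List ℕ, (∀ a ∈ l', a ≤ r) → wordAct r l'.reverse y ∈ CplusCl r →
        l.length ≤ l'.length
  then h.choose else []

/-- `g_y`, the unique shortest element of `W` with `g_y⁻¹ y` in the closed alcove. -/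
def gfun (y : E r) : E r → E r := fun z => wordAct r (gW r y) z

/-- The Bruhat order on `(W, {s₀,…,s_r})`, via the subword characterisation. -/
def bruhatLE (u v : E r → E r) : Prop :=
  ∃ l : List ℕ, (∀ a ∈ l, a ≤ r) ∧ (fun z => wordAct r l z) = v ∧ l.length = wlen r v ∧
    ∃ l' : List ℕ, l'.Sublist l ∧ (fun z => wordAct r l' z) = u ∧ l'.length = wlen r u

/-- The partial order on `ℝ^r`: `y' ≤ y` iff `y'` and `y` lie in the same `W`-orbit and
`g_{y'} ≤_B g_y` in the Bruhat order. -/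
def qle (y' y : E r) : Prop :=
  (∃ l : List ℕ, (∀ a ∈ l, a ≤ r) ∧ wordAct r l y = y') ∧ bruhatLE r (gfun r y') (gfun r y)

/-- Strict version of `qle`. -/
def qlt (y' y : E r) : Prop := qle r y' y ∧ y' ≠ y

/-- The `F`-linear operator on `F[ℝ^r]` determined by its values on the quasi-monomials. -/
def mkOp (Ψ : E r → QA F r) : Module.End F (QA F r) :=
  Finsupp.linearCombination F Ψ ∘ₗ (AddMonoidAlgebra.coeffLinearEquiv F).toLinearMap

/-- `F[O] = span_F {x^y : y ∈ O}`. -/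
def FO (O : Set (E r)) : Submodule F (QA F r) :=
  Submodule.span F {p | ∃ y ∈ O, p = X F r y}

/-- The Laurent polynomial subalgebra `F[ℤ^r] = span_F {x^μ : μ ∈ ℤ^r}`. -/
def Lspan : Submodule F (QA F r) :=
  Submodule.span F {p | ∃ lam : Fin r → ℤ, p = X F r (zc r lam)}

/-- `span_F {x^{y'} : y' < y}`. -/
def ltSpan (y : E r) : Submodule F (QA F r) :=
  Submodule.span F {p | ∃ y', qlt r y' y ∧ p = X F r y'}

/-! ### Floors and indicator/sign functions -/

/-- the largest even integer `≤ z` -/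
def floorE (z : ℝ) : ℤ := 2 * ⌊z / 2⌋
/-- the largest odd integer `≤ z` -/
def floorO (z : ℝ) : ℤ := 2 * ⌊(z + 1) / 2⌋ - 1
/-- indicator of `ℤ ⊆ ℝ` -/
def chiZ (z : ℝ) : ℕ := if ∃ n : ℤ, z = n then 1 else 0
/-- indicator of the even integers -/
def chiE (z : ℝ) : ℕ := if ∃ n : ℤ, z = 2 * n then 1 else 0
/-- indicator of the odd integers -/
def chiO (z : ℝ) : ℕ := if ∃ n : ℤ, z = 2 * n + 1 then 1 else 0
/-- `η_e`: `1` on even integers `≥ 2`, `-1` on even integers `≤ 0`, `0` otherwise -/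
def etaE (z : ℝ) : ℤ := if ∃ n : ℤ, z = 2 * n then (if 2 ≤ z then 1 else -1) else 0
/-- `η_o`: `1` on odd integers `≥ 1`, `-1` on odd integers `≤ -1`, `0` otherwise -/
def etaO (z : ℝ) : ℤ := if ∃ n : ℤ, z = 2 * n + 1 then (if 1 ≤ z then 1 else -1) else 0
/-- `η = η_e + η_o` -/
def eta (z : ℝ) : ℤ := etaE z + etaO z

/-- `geomS c v m` is the truncated geometric series `(1 - (c·x^v)^m)/(1 - c·x^v)`,
a genuine element of `F[ℝ^r]`; it is the unique element with
`(1 - c·x^v) * geomS c v m = 1 - c^m·x^{m v}`. -/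
def geomS (c : F) (v : E r) (m : ℤ) : QA F r :=
  if 0 ≤ m then ∑ t ∈ Finset.range m.toNat, c ^ (t : ℤ) • X F r ((t : ℝ) • v)
  else -∑ t ∈ Finset.range (-m).toNat, c ^ (-(t : ℤ) - 1) • X F r ((-(t : ℝ) - 1) • v)

/-! ### Truncated divided difference operators and Demazure–Lusztig operators -/

/-- `∇_i(x^y) = ((1 - (x_{i+1}/x_i)^{⌊y_i - y_{i+1}⌋})/(1 - x_i/x_{i+1}))·x^y`. -/
def nablaIel (i : ℕ) (y : E r) : QA F r :=
  geomS F r 1 (epsV r i - epsV r (i + 1)) (-⌊cd r y i - cd r y (i + 1)⌋) * X F r y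

/-- `∇_r^e(x^y) = ((1 - x_r^{-⌊2y_r⌋_e})/(1 - x_r^2))·x^y`. -/
def nablaReEl (y : E r) : QA F r :=
  geomS F r 1 ((2 : ℝ) • epsV r r) (-floorE (2 * cd r y r) / 2) * X F r y

/-- `∇_r^o(x^y) = ((x_r - x_r^{-⌊2y_r⌋_o})/(1 - x_r^2))·x^y`. -/
def nablaRoEl (y : E r) : QA F r :=
  X F r (epsV r r) *
    geomS F r 1 ((2 : ℝ) • epsV r r) ((-floorO (2 * cd r y r) - 1) / 2) * X F r y

def nablaIop (i : ℕ) : Module.End F (QA F r) := mkOp F r (nablaIel F r i)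
def nablaReOp : Module.End F (QA F r) := mkOp F r (nablaReEl F r)
def nablaRoOp : Module.End F (QA F r) := mkOp F r (nablaRoEl F r)

/-- The value of the truncated Demazure–Lusztig operator `T_i` (`1 ≤ i ≤ r`) on `x^y`. -/
def Tel (k kr ur : F) (i : ℕ) (y : E r) : QA F r :=
  if i = r then
    (kr ^ chiE (2 * cd r y r) * ur ^ chiO (2 * cd r y r)) • X F r (sW r r y)
      + (kr - kr⁻¹) • nablaReEl F r y + (ur - ur⁻¹) • nablaRoEl F r y
  else
    k ^ chiZ (cd r y i - cd r y (i + 1)) • X F r (sW r i y)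
      + (k - k⁻¹) • nablaIel F r i y

/-- The truncated Demazure–Lusztig operators `T_1, …, T_r` on `F[ℝ^r]`. -/
def Top (k kr ur : F) (i : ℕ) : Module.End F (QA F r) := mkOp F r (Tel F r k kr ur i)

/-! ### The torus and the affine generator -/

/-- `t^{ε_i}`: the `i`-th coordinate (`1`-based) of an element of the torus `T = (Fˣ)^r`. -/
def tcU (t : Fin r → Fˣ) (i : ℕ) : Fˣ := ∏ m : Fin r, if (m : ℕ) + 1 = i then t m else 1

/-- `t^λ` for `λ ∈ ℤ^r`. -/
def upow (t : Fin r → Fˣ) (lam : Fin r → ℤ) : Fˣ := ∏ m : Fin r, t m ^ lam m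

/-- `t^v` for a vector `v` with integral entries (entries read off via the floor). -/
def upowR (t : Fin r → Fˣ) (v : E r) : Fˣ := ∏ m : Fin r, t m ^ ⌊v m⌋

/-- The `W`-action on the torus `T = (Fˣ)^r`: for `g = τ(λ)w₀ ∈ W` (so `g y = w₀ y + λ`),
`(g t)_m = q^{λ_m} · t^{w₀⁻¹ ε_m}`, where `W₀` permutes and inverts coordinates and
`τ(λ) t = q^λ t`, with `q = (q^{1/2})²`. -/
def torusAct (qh : Fˣ) (g : E r → E r) (t : Fin r → Fˣ) : Fin r → Fˣ := fun m =>
  (qh * qh) ^ ⌊g 0 m⌋ * ∏ j : Fin r, t j ^ ⌊(g (eV r j) - g 0) m⌋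

/-- The action on the torus of the linear part of `g` alone (the `W₀`-action). -/
def torusAct0 (g : E r → E r) (t : Fin r → Fˣ) : Fin r → Fˣ := fun m =>
  ∏ j : Fin r, t j ^ ⌊(g (eV r j) - g 0) m⌋

/-- The simple affine roots `α₀(y) = 1 - 2y₁`, `α_i(y) = y_i - y_{i+1}` (`1 ≤ i < r`),
`α_r(y) = 2 y_r` as affine-linear functionals. -/
def alphaF (j : ℕ) (y : E r) : ℝ :=
  if j = 0 then 1 - 2 * cd r y 1
  else if j = r then 2 * cd r y r
  else cd r y j - cd r y (j + 1)

/-- `t^{α_j^∨}` where `α₀^∨ = (-ε₁, 1/2)`, `α_i^∨ = (ε_i - ε_{i+1}, 0)`, `α_r^∨ = (ε_r, 0)`. -/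
def tpowCo (qh : Fˣ) (t : Fin r → Fˣ) (j : ℕ) : Fˣ :=
  if j = 0 then qh * (tcU F r t 1)⁻¹
  else if j = r then tcU F r t r
  else tcU F r t j * (tcU F r t (j + 1))⁻¹

/-- The affine subtorus `T_𝒪 = {t ∈ T : t^{α_j^∨} = 1 whenever α_j(c^𝒪) = 0}`. -/
def TOset (qh : Fˣ) (O : Set (E r)) : Set (Fin r → Fˣ) :=
  {t | ∀ j : ℕ, j ≤ r → alphaF r j (cpt r O) = 0 → tpowCo F r qh t j = 1}

/-- `∇₀^e(x^y) = ((1 - (q^{-1/2}x₁)^{⌊-2y₁⌋_e})/(1 - q x₁^{-2}))·x^y`. -/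
def nabla0eEl (qh : F) (y : E r) : QA F r :=
  geomS F r (qh * qh) ((-2 : ℝ) • epsV r 1) (-floorE (-2 * cd r y 1) / 2) * X F r y

/-- `∇₀^o(x^y) = ((q^{1/2}x₁^{-1} - (q^{-1/2}x₁)^{⌊-2y₁⌋_o})/(1 - q x₁^{-2}))·x^y`. -/
def nabla0oEl (qh : F) (y : E r) : QA F r :=
  (qh • X F r ((-1 : ℝ) • epsV r 1)) *
    geomS F r (qh * qh) ((-2 : ℝ) • epsV r 1) ((-floorO (-2 * cd r y 1) - 1) / 2) * X F r y

/-- The value of `T₀^𝒪` on `x^y`. -/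
def T0el (qh : Fˣ) (k0 u0 : F) (t : Fin r → Fˣ) (y : E r) : QA F r :=
  (k0 ^ chiE (2 * cd r y 1) * u0 ^ chiO (2 * cd r y 1) *
      ((tcU F r (torusAct F r qh (gfun r y) t) 1 : Fˣ) : F)) • X F r (sEps1 r y)
    + (k0 - k0⁻¹) • nabla0eEl F r qh y + (u0 - u0⁻¹) • nabla0oEl F r qh y

/-- The operator `T₀^𝒪` (as a globally defined operator; on `F[𝒪]` it is the operator of
the quasi-polynomial representation). -/
def T0op (qh : Fˣ) (k0 u0 : F) (t : Fin r → Fˣ) : Module.End F (QA F r) :=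
  mkOp F r (T0el F r qh k0 u0 t)

/-- The full family `T₀^𝒪, T₁, …, T_r`. -/
def Tfull (qh : Fˣ) (k0 u0 k kr ur : F) (t : Fin r → Fˣ) (j : ℕ) : Module.End F (QA F r) :=
  if j = 0 then T0op F r qh k0 u0 t else Top F r k kr ur j

/-- The Hecke parameter `k_j` (`k₀`, `k` or `k_r`). -/
def kpar (k0 k kr : F) (j : ℕ) : F := if j = 0 then k0 else if j = r then kr else k

/-- `(T_j^𝒪)⁻¹ = T_j^𝒪 - k_j + k_j⁻¹` (the inverse on `F[𝒪]`, by the Hecke relation). -/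
def TfullInv (qh : Fˣ) (k0 u0 k kr ur : F) (t : Fin r → Fˣ) (j : ℕ) : Module.End F (QA F r) :=
  Tfull F r qh k0 u0 k kr ur t j - (kpar F r k0 k kr j - (kpar F r k0 k kr j)⁻¹) • 1

/-- The word `0, 1, …, r-1, r, r-1, …, i` used in the definition of `Y_i^𝒪`. -/
def Ylist (i : ℕ) : List ℕ :=
  0 :: (((List.range (r - 1)).map (· + 1)) ++ [r] ++ ((List.range (r - i)).map fun m => r - 1 - m))

/-- The commuting operators
`Y_i^𝒪 = (T_{i-1}^𝒪)⁻¹⋯(T₁^𝒪)⁻¹ · T₀^𝒪 · T₁^𝒪⋯T_{r-1}^𝒪 · T_r^𝒪 · T_{r-1}^𝒪⋯T_i^𝒪`. -/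
def Yop (qh : Fˣ) (k0 u0 k kr ur : F) (t : Fin r → Fˣ) (i : ℕ) : Module.End F (QA F r) :=
  ((((List.range (i - 1)).map (· + 1)).reverse.map (TfullInv F r qh k0 u0 k kr ur t)).prod) *
    (((Ylist r i).map (Tfull F r qh k0 u0 k kr ur t)).prod)

/-! ### The base points `𝔰^𝒪`, `𝔰_y` and the spectrum -/

/-- `n_i^𝒪` (with `c = c^𝒪`), resp. `m_i(y)` (with `c = y`). -/
def nO (c : E r) (m : Fin r) : ℤ :=
  (∑ j : Fin r, if m < j then eta (c m - c j) + eta (c m + c j) else 0) +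
    ∑ j : Fin r, if j < m then eta (c j + c m) - eta (c j - c m) else 0

/-- The base point `𝔰^𝒪 ∈ T`. -/
def sOtor (k0 u0 k kr ur : Fˣ) (O : Set (E r)) : Fin r → Fˣ := fun m =>
  (k0 * kr) ^ (-(chiE (2 * cpt r O m) : ℤ)) * (u0 * ur) ^ (chiO (2 * cpt r O m) : ℤ) *
    k ^ nO r (cpt r O) m

/-- The eigenvalue `γ_i^𝒪(y) = ((g_y(𝔰^𝒪·t))_i)⁻¹`. -/
def gammaO (qh k0 u0 k kr ur : Fˣ) (O : Set (E r)) (t : Fin r → Fˣ) (i : ℕ) (y : E r) : Fˣ :=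
  (tcU F r (torusAct F r qh (gfun r y) fun m => sOtor F r k0 u0 k kr ur O m * t m) i)⁻¹

/-- `𝔰_y ∈ T`. -/
def sfrak (k0 u0 k kr ur : Fˣ) (y : E r) : Fin r → Fˣ := fun m =>
  (k0 * kr) ^ etaE (2 * y m) * (u0 * ur) ^ etaO (2 * y m) * k ^ nO r y m

/-! ### Finite Weyl group combinatorics, positive roots -/

/-- The set of positive roots of type `C_r`. -/
def PhiPlus : Set (E r) :=
  {v | (∃ a b : Fin r, a < b ∧ v = eV r a - eV r b) ∨
       (∃ a b : Fin r, a < b ∧ v = eV r a + eV r b) ∨ ∃ a : Fin r, v = (2 : ℝ) • eV r a}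

/-- The root system of type `C_r`. -/
def Phi0 : Set (E r) := PhiPlus r ∪ {v | -v ∈ PhiPlus r}

/-- The normalisation factor `κ_w^𝒪 = ∏_{α ∈ Π(w)} 𝐤_α^{χ_e(α(c))}·𝐤_{α/2}^{-χ_o(α(c))}`,
where `Π(w) = {α ∈ Φ₀⁺ : wα ∈ -Φ₀⁺}`, `𝐤_α = 𝐤_{α/2} = k` for short roots and
`𝐤_α = k_r`, `𝐤_{α/2} = u_r` for long roots. -/
def kappaW (k kr ur : Fˣ) (w : E r → E r) (c : E r) : Fˣ :=
  (∏ p : Fin r × Fin r,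
      if p.1 < p.2 ∧ -w (eV r p.1 - eV r p.2) ∈ PhiPlus r then
        k ^ ((chiE (ip r (eV r p.1 - eV r p.2) c) : ℤ) - (chiO (ip r (eV r p.1 - eV r p.2) c) : ℤ))
      else 1) *
  (∏ p : Fin r × Fin r,
      if p.1 < p.2 ∧ -w (eV r p.1 + eV r p.2) ∈ PhiPlus r then
        k ^ ((chiE (ip r (eV r p.1 + eV r p.2) c) : ℤ) - (chiO (ip r (eV r p.1 + eV r p.2) c) : ℤ))
      else 1) *
  ∏ a : Fin r,
      if -w ((2 : ℝ) • eV r a) ∈ PhiPlus r then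
        kr ^ (chiE (ip r ((2 : ℝ) • eV r a) c) : ℤ) * ur ^ (-(chiO (ip r ((2 : ℝ) • eV r a) c) : ℤ))
      else 1

/-- Iterated application `T_{i₁}(T_{i₂}(⋯(T_{i_ℓ}(f))⋯))`. -/
def applyT (k kr ur : F) (l : List ℕ) (f : QA F r) : QA F r :=
  l.foldr (fun i g => Top F r k kr ur i g) f

/-- The length function of the finite Weyl group `W₀`. -/
def w0len (g : E r → E r) : ℕ :=
  sInf {n | ∃ l : List ℕ, (∀ a ∈ l, 1 ≤ a ∧ a ≤ r) ∧ l.length = n ∧ (fun y => wordAct r l y) = g}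

/-- Membership in `W₀` (as maps on `ℝ^r`). -/
def IsW0fun (w : E r → E r) : Prop :=
  ∃ l : List ℕ, (∀ a ∈ l, 1 ≤ a ∧ a ≤ r) ∧ w = fun y => wordAct r l y

/-- Membership in the parabolic subgroup `W_{0,𝒪}` generated by the `s_i`, `1 ≤ i ≤ r`,
with `α_i(c^𝒪) = 0`. -/
def IsWOOfun (O : Set (E r)) (u : E r → E r) : Prop :=
  ∃ l : List ℕ, (∀ a ∈ l, 1 ≤ a ∧ a ≤ r ∧ alphaF r a (cpt r O) = 0) ∧
    u = fun y => wordAct r l y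

/-- `v ∈ W₀^𝒪`: `v ∈ W₀` of minimal length in its coset `v·W_{0,𝒪}`. -/
def MinRep (O : Set (E r)) (v : E r → E r) : Prop :=
  IsW0fun r v ∧ ∀ u, IsWOOfun r O u → w0len r v ≤ w0len r fun y => v (u y)

/-- Membership in the affine Weyl group `W` (as maps on `ℝ^r`). -/
def IsWfun (g : E r → E r) : Prop :=
  ∃ l : List ℕ, (∀ a ∈ l, a ≤ r) ∧ g = fun y => wordAct r l y

/-- Membership in the parabolic subgroup `W_{J(𝒪)}` generated by the `s_j`, `j ∈ J(𝒪)`. -/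
def IsWJfun (O : Set (E r)) (u : E r → E r) : Prop :=
  ∃ l : List ℕ, (∀ a ∈ l, a ≤ r ∧ alphaF r a (cpt r O) = 0) ∧ u = fun y => wordAct r l y

/-- The `W`-action on the Laurent polynomials `F[ℤ^r]` by `q`-dilations and reflections:
`w(x^μ) = x^{wμ}` for `w ∈ W₀`, `τ(λ)(x^μ) = q^{-⟨μ,λ⟩} x^μ` (globally defined via the
linear/translation parts of `g`). -/
def LWact (qh : Fˣ) (g : E r → E r) : Module.End F (QA F r) :=
  mkOp F r fun v => (((qh * qh) ^ (-⌊ip r (g v - g 0) (g 0)⌋) : Fˣ) : F) • X F r (g v - g 0)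

/-! ### roots `ᾱ_j`, torus reflections -/

/-- The finite simple roots `ᾱ₀ = -2ε₁`, `ᾱ_i = ε_i - ε_{i+1}`, `ᾱ_r = 2ε_r`
(as integral vectors). -/
def abarI (j : ℕ) : Fin r → ℤ := fun m =>
  if j = 0 then (if (m : ℕ) = 0 then -2 else 0)
  else if j = r then (if (m : ℕ) + 1 = r then 2 else 0)
  else if (m : ℕ) + 1 = j then 1
  else if (m : ℕ) = j then -1
  else 0

/-- The corresponding coroots `ᾱ₀^∨ = -ε₁`, `ᾱ_i^∨ = ε_i - ε_{i+1}`, `ᾱ_r^∨ = ε_r`. -/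
def abarV (j : ℕ) : Fin r → ℤ := fun m =>
  if j = 0 then (if (m : ℕ) = 0 then -1 else 0)
  else if j = r then (if (m : ℕ) + 1 = r then 1 else 0)
  else if (m : ℕ) + 1 = j then 1
  else if (m : ℕ) = j then -1
  else 0

/-- `ᾱ_j` as a real vector. -/
def abarR (j : ℕ) : E r := fun m => ((abarI r j m : ℤ) : ℝ)

/-- The constants `c₀ = u₀u_r`, `c_i = k²`, `c_r = k₀k_r`. -/
def cpar (k0 u0 k kr ur : Fˣ) (j : ℕ) : Fˣ :=
  if j = 0 then u0 * ur else if j = r then k0 * kr else k * k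

/-- The action of the reflection `s_{ᾱ_j} ∈ W₀` on the torus `T` (with `s_{ᾱ₀} = s_{ε₁}`). -/
def sTor (j : ℕ) (t : Fin r → Fˣ) : Fin r → Fˣ := fun m =>
  if j = 0 then (if (m : ℕ) = 0 then (t m)⁻¹ else t m)
  else if j = r then (if (m : ℕ) + 1 = r then (t m)⁻¹ else t m)
  else if (m : ℕ) + 1 = j then tcU F r t (j + 1)
  else if (m : ℕ) = j then tcU F r t j
  else t m

/-! ### The operators `G_t^𝒪(a)` for affine roots `a = (α, n)` -/

/-- The coroot `α^∨ = 2α/⟨α,α⟩`. -/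
def coroot (v : E r) : E r := ((2 : ℝ) / ip r v v) • v

/-- The scalar `q^{2n/⟨α,α⟩}` appearing in `x^{a^∨}` for `a = (α,n)`. -/
def qsc (qh : Fˣ) (v : E r) (n : ℤ) : Fˣ := if ip r v v = 4 then qh ^ n else (qh * qh) ^ n

/-- `𝐤_a`: `k` if `α` is short; `k_r` if `α` long, `n` even; `k₀` if `α` long, `n` odd. -/
def kaf (k0 k kr : Fˣ) (v : E r) (n : ℤ) : Fˣ :=
  if ip r v v = 4 then (if Even n then kr else k0) else k

/-- `𝐤_{a/2}`: `k` if `α` is short; `u_r` if `α` long, `n` even; `u₀` if `α` long, `n` odd. -/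
def khaf (u0 k ur : Fˣ) (v : E r) (n : ℤ) : Fˣ :=
  if ip r v v = 4 then (if Even n then ur else u0) else k

/-- The reflection `s_α(y) = y - α(y)·α^∨`. -/
def sRefl (v y : E r) : E r := y - ip r v y • coroot r v

/-- `s_{a,t}(x^y) = (g_y t)^{-n α^∨} · x^{s_α y}`. -/
def saTel (qh : Fˣ) (t : Fin r → Fˣ) (v : E r) (n : ℤ) (y : E r) : QA F r :=
  ((upowR F r (torusAct F r qh (gfun r y) t) (((-n : ℤ) : ℝ) • coroot r v) : Fˣ) : F) •
    X F r (sRefl r v y)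

/-- The twisted reflection operator `s_{a,t}`. -/
def SaOp (qh : Fˣ) (t : Fin r → Fˣ) (v : E r) (n : ℤ) : Module.End F (QA F r) :=
  mkOp F r (saTel F r qh t v n)

/-- The value `G_t^𝒪(a)(x^y)` for the affine root `a = (v, n)`. -/
def Gel (qh k0 u0 k kr ur : Fˣ) (t : Fin r → Fˣ) (v : E r) (n : ℤ) (y : E r) : QA F r :=
  (((kaf F r k0 k kr v n : Fˣ) : F) ^ chiE (ip r v y) *
      ((khaf F r u0 k ur v n : Fˣ) : F) ^ chiO (ip r v y)) • X F r y
    + ((((kaf F r k0 k kr v n : Fˣ) : F) - ((kaf F r k0 k kr v n : Fˣ) : F)⁻¹) •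
          geomS F r (((qsc F r qh v n)⁻¹ * (qsc F r qh v n)⁻¹ : Fˣ) : F)
            ((-2 : ℝ) • coroot r v) (-floorE (ip r v y) / 2)
        + (((khaf F r u0 k ur v n : Fˣ) : F) - ((khaf F r u0 k ur v n : Fˣ) : F)⁻¹) •
          ((((qsc F r qh v n)⁻¹ : Fˣ) : F) • X F r ((-1 : ℝ) • coroot r v) *
            geomS F r (((qsc F r qh v n)⁻¹ * (qsc F r qh v n)⁻¹ : Fˣ) : F)
              ((-2 : ℝ) • coroot r v) (-(floorO (ip r v y) + 1) / 2))) *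
      saTel F r qh t v n y

/-- The operator `G_t^𝒪(a)` for `a = (v, n)`. -/
def Gop (qh k0 u0 k kr ur : Fˣ) (t : Fin r → Fˣ) (v : E r) (n : ℤ) : Module.End F (QA F r) :=
  mkOp F r (Gel F r qh k0 u0 k kr ur t v n)

/-- The twisted action `g_t` of `g ∈ W` on `F[𝒪]`:
`g_t(x^y) = (g_{w₀ y} t)^{-λ} x^{w₀ y}` for `g = τ(λ) w₀`. -/
def Wtw (qh : Fˣ) (t : Fin r → Fˣ) (g : E r → E r) : Module.End F (QA F r) :=
  mkOp F r fun y =>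
    (((upowR F r (torusAct F r qh (gfun r (g y - g 0)) t) (g 0))⁻¹ : Fˣ) : F) •
      X F r (g y - g 0)

/-! ### The operators `D_j` -/

/-- The palindromic word `1, …, r-1, r, r-1, …, 1`. -/
def palin : List ℕ :=
  ((List.range (r - 1)).map (· + 1)) ++ [r] ++ ((List.range (r - 1)).map (· + 1)).reverse

/-- Multiplication by `x^{-ε₁}`. -/
def Mop : Module.End F (QA F r) := mkOp F r fun y => X F r ((-1 : ℝ) • epsV r 1) * X F r y

/-- `D₀ = (T₁^𝒪 ⋯ T_{r-1}^𝒪 T_r^𝒪 T_{r-1}^𝒪 ⋯ T₁^𝒪)⁻¹ ∘ M`. -/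
def D0op (qh : Fˣ) (k0 u0 k kr ur : F) (t : Fin r → Fˣ) : Module.End F (QA F r) :=
  ((palin r).map (TfullInv F r qh k0 u0 k kr ur t)).prod * Mop F r

/-- `D_j`: `D₀` for `j = 0` and `T_j^𝒪` for `1 ≤ j ≤ r`. -/
def Dop (qh : Fˣ) (k0 u0 k kr ur : F) (t : Fin r → Fˣ) (j : ℕ) : Module.End F (QA F r) :=
  if j = 0 then D0op F r qh k0 u0 k kr ur t else Tfull F r qh k0 u0 k kr ur t j

/-- Iterated application `D_{j₁}(D_{j₂}(⋯(D_{j_ℓ}(f))⋯))`. -/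
def applyD (qh : Fˣ) (k0 u0 k kr ur : F) (t : Fin r → Fˣ) (l : List ℕ) (f : QA F r) : QA F r :=
  l.foldr (fun j g => Dop F r qh k0 u0 k kr ur t j g) f

/-- The coefficients `k_{s_j}(y)`. -/
def ksj (k kr ur : Fˣ) (j : ℕ) (y : E r) : Fˣ :=
  if j = 0 then
    kr ^ (-etaE (2 * cd r y 1)) * ur ^ (-etaO (2 * cd r y 1)) *
      ∏ m : Fin r,
        (if 1 ≤ (m : ℕ) then k ^ (-eta (cd r y 1 - y m) - eta (cd r y 1 + y m)) else 1)
  else if j = r then kr ^ (-etaE (2 * cd r y r)) * ur ^ (-etaO (2 * cd r y r))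
  else k ^ (-eta (cd r y j - cd r y (j + 1)))

/-- `k_w(c) = ∏_m k_{s_{j_m}}(s_{j_{m+1}} ⋯ s_{j_ℓ} c)` for the word `w = s_{j₁} ⋯ s_{j_ℓ}`. -/
def kword (k kr ur : Fˣ) (l : List ℕ) (z : E r) : Fˣ :=
  (l.foldr (fun j p => (genF r j p.1, ksj F r k kr ur j p.1 * p.2)) (z, (1 : Fˣ))).2


/-! ### Helper lemmas for the proof -/

section Helpers

variable {r}

lemma h_cd (y : E r) (i : ℕ) (h1 : 1 ≤ i) (h2 : i ≤ r) :
    cd r y i = y ⟨i - 1, by omega⟩ := by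
  unfold cd
  rw [Finset.sum_eq_single (⟨i - 1, by omega⟩ : Fin r)]
  · simp; intro h; omega
  · intro m _ hm
    rw [if_neg]
    intro h
    apply hm
    ext
    simp
    omega
  · simp

lemma h_epsV (i : ℕ) (h1 : 1 ≤ i) (h2 : i ≤ r) :
    epsV r i = eV r ⟨i - 1, by omega⟩ := by
  ext m
  simp only [epsV, eV, Fin.ext_iff]
  congr 1
  simp; omega

/-- The simple root. -/
def srt (r : ℕ) (i : ℕ) : E r :=
  if i = r then (2 : ℝ) • epsV r r else epsV r i - epsV r (i + 1)

lemma ip_eV (m : Fin r) (y : E r) : ip r (eV r m) y = y m := by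
  simp [ip, eV]

lemma ip_add (u v y : E r) : ip r (u + v) y = ip r u y + ip r v y := by
  simp [ip, add_mul, Finset.sum_add_distrib]
lemma ip_sub (u v y : E r) : ip r (u - v) y = ip r u y - ip r v y := by
  simp [ip, sub_mul, Finset.sum_sub_distrib]
lemma ip_smul (a : ℝ) (v y : E r) : ip r (a • v) y = a * ip r v y := by
  simp [ip, mul_assoc, Finset.mul_sum]
lemma ip_comm (u v : E r) : ip r u v = ip r v u := by
  simp [ip, mul_comm]
lemma ip_sub' (u v y : E r) : ip r y (u - v) = ip r y u - ip r y v := by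
  rw [ip_comm, ip_sub, ip_comm u, ip_comm v]
lemma ip_smul' (a : ℝ) (v y : E r) : ip r y (a • v) = a * ip r y v := by
  rw [ip_comm, ip_smul, ip_comm v]

lemma srt_lt (i : ℕ) (h1 : 1 ≤ i) (h2 : i < r) :
    srt r i = eV r ⟨i - 1, by omega⟩ - eV r ⟨i, h2⟩ := by
  rw [srt, if_neg (by omega), h_epsV i h1 h2.le, h_epsV (i + 1) (by omega) h2]
  rfl

lemma srt_r (h1 : 1 ≤ r) :
    srt r r = (2 : ℝ) • eV r ⟨r - 1, by omega⟩ := by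
  rw [srt, if_pos rfl, h_epsV r h1 le_rfl]

lemma eV_apply (a b : Fin r) : eV r a b = if b = a then 1 else 0 := rfl

lemma srt_norm_lt (i : ℕ) (h1 : 1 ≤ i) (h2 : i < r) : ip r (srt r i) (srt r i) = 2 := by
  rw [srt_lt i h1 h2, ip_sub, ip_eV, ip_eV]
  have : i - 1 ≠ i := by omega
  simp [eV_apply, Fin.ext_iff, this, this.symm]; norm_num

lemma srt_norm_r (h1 : 1 ≤ r) : ip r (srt r r) (srt r r) = 4 := by
  rw [srt_r h1, ip_smul, ip_eV]
  simp [eV_apply]; norm_num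

lemma sW_refl (i : ℕ) (h1 : 1 ≤ i) (h2 : i ≤ r) (y : E r) :
    sW r i y = sRefl r (srt r i) y := by
  rcases h2.lt_or_eq with h | h
  · rw [sRefl, coroot, srt_norm_lt i h1 h, srt_lt i h1 h, ip_sub, ip_eV, ip_eV]
    ext m
    simp only [sW, if_neg h.ne, h_cd y i h1 h2, h_cd y (i + 1) (by omega) h, Pi.sub_apply,
      Pi.smul_apply, eV_apply, smul_eq_mul, Fin.ext_iff]
    by_cases ha : (m : ℕ) + 1 = i
    · have : m = ⟨i - 1, by omega⟩ := by ext; simp; omega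
      have h' : i - 1 ≠ i := by omega
      have h'' : (m : ℕ) = i - 1 := by omega
      rw [if_pos ha, if_pos h'', if_neg (by omega), ← this]
      simp
    · by_cases hb : (m : ℕ) = i
      · have : m = ⟨i, by omega⟩ := by ext; simp; omega
        subst this
        have : i ≠ i - 1 := by omega
        simp [this]
      · have : (m : ℕ) ≠ i - 1 := by omega
        simp [ha, hb, this]
  · subst h
    rw [sRefl, coroot, srt_norm_r h1, srt_r h1, ip_smul, ip_eV]
    ext m
    simp only [sW, if_true, Pi.sub_apply,
      Pi.smul_apply, eV_apply, smul_eq_mul, Fin.ext_iff]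
    by_cases ha : (m : ℕ) + 1 = i
    · have : m = ⟨i - 1, by omega⟩ := by ext; simp; omega
      have h'' : (m : ℕ) = i - 1 := by omega
      rw [if_pos ha, if_pos h'', ← this]
      ring
    · have : (m : ℕ) ≠ i - 1 := by omega
      simp [ha, this]

lemma srt_norm_ne (i : ℕ) (h1 : 1 ≤ i) (h2 : i ≤ r) : ip r (srt r i) (srt r i) ≠ 0 := by
  rcases h2.lt_or_eq with h | h
  · rw [srt_norm_lt i h1 h]; norm_num
  · subst h; rw [srt_norm_r h1]; norm_num

lemma sRefl_add (v x y : E r) : sRefl r v (x + y) = sRefl r v x + sRefl r v y := by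
  simp only [sRefl, ip_comm v (x + y), ip_add, ip_comm x, ip_comm y]; module
lemma sRefl_smul (v : E r) (a : ℝ) (y : E r) : sRefl r v (a • y) = a • sRefl r v y := by
  simp only [sRefl, ip_smul']; module
lemma sRefl_neg (v y : E r) : sRefl r v (-y) = -sRefl r v y := by
  have := sRefl_smul v (-1) y; simpa using this
lemma sRefl_sub (v x y : E r) : sRefl r v (x - y) = sRefl r v x - sRefl r v y := by
  rw [sub_eq_add_neg, sRefl_add, sRefl_neg, sub_eq_add_neg]

lemma sRefl_ip (v x y : E r) (hv : ip r v v ≠ 0) :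
    ip r (sRefl r v x) (sRefl r v y) = ip r x y := by
  simp only [sRefl, coroot, ip_sub, ip_sub', ip_smul, ip_smul', ip_comm x v]
  field_simp; ring

lemma sRefl_invol (v y : E r) (hv : ip r v v ≠ 0) : sRefl r v (sRefl r v y) = y := by
  have h : ip r v (sRefl r v y) = - ip r v y := by
    simp only [sRefl, coroot, ip_sub', ip_smul']
    field_simp; ring
  conv_lhs => rw [sRefl, h, sRefl]
  module

lemma sRefl_self (v : E r) (hv : ip r v v ≠ 0) : sRefl r v v = -v := by
  simp only [sRefl, coroot, smul_smul]
  rw [mul_div_cancel₀ _ hv]; module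

lemma sRefl_conj (v b z : E r) (hv : ip r v v ≠ 0) :
    sRefl r v (sRefl r (sRefl r v b) z) = sRefl r b (sRefl r v z) := by
  have h1 : ip r (sRefl r v b) z = ip r b (sRefl r v z) := by
    rw [← sRefl_ip v (sRefl r v b) z hv, sRefl_invol v b hv]
  conv_lhs => rw [sRefl.eq_1 r (sRefl r v b) z, coroot]
  rw [sRefl_sub, sRefl_smul, sRefl_smul, sRefl_invol v b hv, sRefl_ip v b b hv, h1]
  rw [sRefl.eq_1 r b, coroot]

lemma mem_diff {a b : Fin r} (h : a < b) : eV r a - eV r b ∈ PhiPlus r :=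
  Or.inl ⟨a, b, h, rfl⟩
lemma mem_sum {a b : Fin r} (h : a ≠ b) : eV r a + eV r b ∈ PhiPlus r := by
  rcases lt_or_gt_of_ne h with h | h
  · exact Or.inr (Or.inl ⟨a, b, h, rfl⟩)
  · exact Or.inr (Or.inl ⟨b, a, h, add_comm _ _⟩)
lemma mem_long (a : Fin r) : (2 : ℝ) • eV r a ∈ PhiPlus r :=
  Or.inr (Or.inr ⟨a, rfl⟩)

lemma srt_mem (i : ℕ) (h1 : 1 ≤ i) (h2 : i ≤ r) : srt r i ∈ PhiPlus r := by
  rcases h2.lt_or_eq with h | h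
  · rw [srt_lt i h1 h]; apply mem_diff; simp [Fin.lt_def]; omega
  · subst h; rw [srt_r h1]; exact mem_long _

lemma sRefl_eV_lt (i : ℕ) (h1 : 1 ≤ i) (h2 : i < r) (m : Fin r) :
    sRefl r (srt r i) (eV r m) = eV r (Equiv.swap ⟨i - 1, by omega⟩ ⟨i, h2⟩ m) := by
  rw [sRefl, coroot, srt_norm_lt i h1 h2, srt_lt i h1 h2, ip_sub, ip_eV, ip_eV, eV_apply, eV_apply]
  have hne : (⟨i - 1, by omega⟩ : Fin r) ≠ ⟨i, h2⟩ := by simp; omega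
  by_cases ha : m = ⟨i - 1, by omega⟩
  · rw [ha, Equiv.swap_apply_left, if_pos rfl, if_neg hne.symm]; module
  · by_cases hb : m = ⟨i, h2⟩
    · rw [hb, Equiv.swap_apply_right, if_pos rfl, if_neg hne]; module
    · rw [Equiv.swap_apply_of_ne_of_ne ha hb, if_neg (Ne.symm ha), if_neg (Ne.symm hb)]; module

lemma sRefl_eV_r (h1 : 1 ≤ r) (m : Fin r) :
    sRefl r (srt r r) (eV r m) = if m = ⟨r - 1, by omega⟩ then -eV r m else eV r m := by
  rw [sRefl, coroot, srt_norm_r h1, srt_r h1, ip_smul, ip_eV, eV_apply]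
  split_ifs with h h' h'
  · rw [← h]; module
  · exact absurd h.symm h'
  · exact absurd h'.symm h
  · module

/-- A simple reflection permutes the positive roots other than the simple root. -/
lemma simple_perm (i : ℕ) (h1 : 1 ≤ i) (h2 : i ≤ r) (v : E r) (hv : v ∈ PhiPlus r)
    (hne : v ≠ srt r i) : sRefl r (srt r i) v ∈ PhiPlus r := by
  rcases h2.lt_or_eq with h | h
  · rcases hv with ⟨a, b, hab, rfl⟩ | ⟨a, b, hab, rfl⟩ | ⟨a, rfl⟩
    · rw [sRefl_sub, sRefl_eV_lt i h1 h, sRefl_eV_lt i h1 h]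
      apply mem_diff
      have : ¬ (a = ⟨i - 1, by omega⟩ ∧ b = ⟨i, h⟩) := by
        rintro ⟨ha, hb⟩; exact hne (by rw [srt_lt i h1 h, ha, hb])
      simp only [Equiv.swap_apply_def]
      simp only [Fin.ext_iff, Fin.lt_def] at *
      split_ifs <;> simp <;> omega
    · rw [sRefl_add, sRefl_eV_lt i h1 h, sRefl_eV_lt i h1 h]
      apply mem_sum
      simpa using hab.ne
    · rw [sRefl_smul, sRefl_eV_lt i h1 h]
      exact mem_long _
  · subst h
    rcases hv with ⟨a, b, hab, rfl⟩ | ⟨a, b, hab, rfl⟩ | ⟨a, rfl⟩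
    · rw [sRefl_sub, sRefl_eV_r h1, sRefl_eV_r h1, if_neg]
      · split_ifs
        · rw [sub_neg_eq_add]; exact mem_sum hab.ne
        · exact mem_diff hab
      · simp [Fin.ext_iff]; rw [Fin.lt_def] at hab; omega
    · rw [sRefl_add, sRefl_eV_r h1, sRefl_eV_r h1, if_neg]
      · split_ifs
        · rw [← sub_eq_add_neg]; exact mem_diff hab
        · exact mem_sum hab.ne
      · simp [Fin.ext_iff]; rw [Fin.lt_def] at hab; omega
    · rw [sRefl_smul, sRefl_eV_r h1, if_neg]
      · exact mem_long _
      · rintro rfl; exact hne (srt_r h1).symm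

/-- A height functional, positive on the positive roots. -/
lemma height_pos (v : E r) (hv : v ∈ PhiPlus r) :
    0 < ip r v (fun m => (r : ℝ) - (m : ℕ)) := by
  have key : ∀ m : Fin r, ((m : ℕ) : ℝ) < r := fun m => by exact_mod_cast m.2
  rcases hv with ⟨a, b, hab, rfl⟩ | ⟨a, b, hab, rfl⟩ | ⟨a, rfl⟩
  · rw [ip_sub, ip_eV, ip_eV]
    have : ((a : ℕ) : ℝ) < ((b : ℕ) : ℝ) := by exact_mod_cast hab
    linarith
  · rw [ip_add, ip_eV, ip_eV]
    linarith [key a, key b]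
  · rw [ip_smul, ip_eV]
    linarith [key a]

lemma not_both (v : E r) (hv : v ∈ PhiPlus r) : -v ∉ PhiPlus r := by
  intro h
  have h1 := height_pos v hv
  have h2 := height_pos (-v) h
  have : ip r (-v) (fun m => (r : ℝ) - (m : ℕ)) = - ip r v (fun m => (r : ℝ) - (m : ℕ)) := by
    have := ip_smul (-1) v (fun m => (r : ℝ) - (m : ℕ)); simpa using this
  linarith

/-- valid finite words -/
def Val (r : ℕ) (l : List ℕ) : Prop := ∀ a ∈ l, 1 ≤ a ∧ a ≤ r

lemma Val.tail {i : ℕ} {l : List ℕ} (h : Val r (i :: l)) : Val r l :=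
  fun a ha => h a (List.mem_cons_of_mem _ ha)
lemma Val.rev {l : List ℕ} (h : Val r l) : Val r l.reverse :=
  fun a ha => h a (List.mem_reverse.1 ha)

lemma wordAct_cons {i : ℕ} (h1 : 1 ≤ i) (h2 : i ≤ r) (l : List ℕ) (y : E r) :
    wordAct r (i :: l) y = sRefl r (srt r i) (wordAct r l y) := by
  show genF r i (wordAct r l y) = _
  rw [genF, if_neg (by omega), sW_refl i h1 h2]

lemma wordAct_append (l l' : List ℕ) (y : E r) :
    wordAct r (l ++ l') y = wordAct r l (wordAct r l' y) := by
  simp [wordAct]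

lemma wordAct_rev_cons {i : ℕ} (h1 : 1 ≤ i) (h2 : i ≤ r) (l : List ℕ) (y : E r) :
    wordAct r (i :: l).reverse y = wordAct r l.reverse (sRefl r (srt r i) y) := by
  rw [List.reverse_cons, wordAct_append, wordAct_cons h1 h2]; rfl

lemma wordAct_neg {l : List ℕ} (hl : Val r l) (y : E r) :
    wordAct r l (-y) = -wordAct r l y := by
  induction l with
  | nil => rfl
  | cons i l ih =>
    obtain ⟨h1, h2⟩ := hl i (by simp)
    rw [wordAct_cons h1 h2, wordAct_cons h1 h2, ih hl.tail, sRefl_neg]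

lemma wordAct_ip {l : List ℕ} (hl : Val r l) (x y : E r) :
    ip r (wordAct r l x) (wordAct r l y) = ip r x y := by
  induction l with
  | nil => rfl
  | cons i l ih =>
    obtain ⟨h1, h2⟩ := hl i (by simp)
    rw [wordAct_cons h1 h2, wordAct_cons h1 h2, sRefl_ip _ _ _ (srt_norm_ne i h1 h2), ih hl.tail]

lemma wordAct_rev {l : List ℕ} (hl : Val r l) (y : E r) :
    wordAct r l.reverse (wordAct r l y) = y := by
  induction l with
  | nil => rfl
  | cons i l ih =>
    obtain ⟨h1, h2⟩ := hl i (by simp)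
    rw [wordAct_rev_cons h1 h2, wordAct_cons h1 h2, sRefl_invol _ _ (srt_norm_ne i h1 h2),
      ih hl.tail]

lemma wordAct_rev' {l : List ℕ} (hl : Val r l) (y : E r) :
    wordAct r l (wordAct r l.reverse y) = y := by
  have := wordAct_rev hl.rev y
  rwa [List.reverse_reverse] at this

lemma wordAct_root {l : List ℕ} (hl : Val r l) (v : E r) (hv : v ∈ PhiPlus r) :
    wordAct r l v ∈ PhiPlus r ∨ -wordAct r l v ∈ PhiPlus r := by
  induction l with
  | nil => exact Or.inl hv
  | cons i l ih =>
    obtain ⟨h1, h2⟩ := hl i (by simp)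
    rw [wordAct_cons h1 h2]
    rcases ih hl.tail with h | h
    · by_cases he : wordAct r l v = srt r i
      · right
        rw [he, sRefl_self _ (srt_norm_ne i h1 h2), neg_neg]; exact srt_mem i h1 h2
      · left; exact simple_perm i h1 h2 _ h he
    · by_cases he : -wordAct r l v = srt r i
      · left
        rw [← neg_neg (wordAct r l v), he, sRefl_neg, sRefl_self _ (srt_norm_ne i h1 h2), neg_neg]
        exact srt_mem i h1 h2
      · right; rw [← sRefl_neg]; exact simple_perm i h1 h2 _ h he

/-- The exchange property. -/
lemma exchange {l : List ℕ} (hl : Val r l) (b : E r) (hb : b ∈ PhiPlus r)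
    (hn : wordAct r l.reverse b ∉ PhiPlus r) :
    ∃ l', Val r l' ∧ l'.length + 1 = l.length ∧
      ∀ y, sRefl r b (wordAct r l y) = wordAct r l' y := by
  induction l generalizing b with
  | nil => exact absurd hb hn
  | cons j l ih =>
    obtain ⟨h1, h2⟩ := hl j (by simp)
    rw [wordAct_rev_cons h1 h2] at hn
    by_cases he : b = srt r j
    · refine ⟨l, hl.tail, rfl, fun y => ?_⟩
      rw [wordAct_cons h1 h2, he, sRefl_invol _ _ (srt_norm_ne j h1 h2)]
    · obtain ⟨l', hl', hlen, hact⟩ := ih hl.tail _ (simple_perm j h1 h2 b hb he) hn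
      refine ⟨j :: l', ?_, by simp [hlen], fun y => ?_⟩
      · intro a ha
        rcases List.mem_cons.1 ha with rfl | ha
        · exact ⟨h1, h2⟩
        · exact hl' a ha
      · rw [wordAct_cons h1 h2, wordAct_cons h1 h2, ← hact,
          sRefl_conj _ _ _ (srt_norm_ne j h1 h2)]

/-- Reducedness. -/
def Red (r : ℕ) (l : List ℕ) : Prop :=
  ∀ l', Val r l' → (∀ y, wordAct r l' y = wordAct r l y) → l.length ≤ l'.length

lemma Red.of_len {l : List ℕ} (h : l.length = w0len r (fun y => wordAct r l y)) : Red r l := by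
  intro l' hl' hact
  rw [h]
  exact Nat.sInf_le ⟨l', hl', rfl, funext hact⟩

lemma Red.tail {i : ℕ} {l : List ℕ} (h1 : 1 ≤ i) (h2 : i ≤ r) (h : Red r (i :: l)) :
    Red r l := by
  intro l' hl' hact
  have := h (i :: l') (by
    intro a ha
    rcases List.mem_cons.1 ha with rfl | ha
    · exact ⟨h1, h2⟩
    · exact hl' a ha) (fun y => by rw [wordAct_cons h1 h2, wordAct_cons h1 h2, hact])
  simpa using this

lemma Red.pos {i : ℕ} {l : List ℕ} (h1 : 1 ≤ i) (h2 : i ≤ r) (hl : Val r l)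
    (h : Red r (i :: l)) : wordAct r l.reverse (srt r i) ∈ PhiPlus r := by
  by_contra hn
  obtain ⟨l', hl', hlen, hact⟩ := exchange hl _ (srt_mem i h1 h2) hn
  have := h l' hl' (fun y => by rw [wordAct_cons h1 h2, hact])
  simp at this
  omega

/-- Positive roots evaluated on the closed alcove lie in `[0,1]`. -/
lemma alcove_bound {c : E r} (hc : c ∈ CplusCl r) {v : E r} (hv : v ∈ PhiPlus r) :
    0 ≤ ip r v c ∧ ip r v c ≤ 1 := by
  obtain ⟨hm, hb⟩ := hc
  rcases hv with ⟨a, b, hab, rfl⟩ | ⟨a, b, hab, rfl⟩ | ⟨a, rfl⟩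
  · rw [ip_sub, ip_eV, ip_eV]
    have := hm a b hab.le
    constructor <;> linarith [(hb a).1, (hb a).2, (hb b).1, (hb b).2]
  · rw [ip_add, ip_eV, ip_eV]
    constructor <;> linarith [(hb a).1, (hb a).2, (hb b).1, (hb b).2]
  · rw [ip_smul, ip_eV]
    constructor <;> linarith [(hb a).1, (hb a).2]

lemma cpt_mem (O : Set (E r)) : cpt r O ∈ CplusCl r := by
  unfold cpt
  split_ifs with h
  · exact h.choose_spec.2
  · refine ⟨fun i j _ => le_rfl, fun m => ?_⟩
    simp



lemma X_mul (x y : E r) : X F r x * X F r y = X F r (x + y) := by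
  simp [X, AddMonoidAlgebra.single_mul_single]

lemma mkOp_X (Ψ : E r → QA F r) (y : E r) : mkOp F r Ψ (X F r y) = Ψ y := by
  simp [mkOp, X]

lemma geomS_zero (c : F) (v : E r) : geomS F r c v 0 = 0 := by
  simp [geomS]

lemma geomS_neg_one (v : E r) : geomS F r 1 v (-1) = -X F r (-v) := by
  simp [geomS]

lemma chiE_zero : chiE 0 = 1 := by
  rw [chiE, if_pos ⟨0, by simp⟩]
lemma chiO_one : chiO 1 = 1 := by
  rw [chiO, if_pos ⟨0, by simp⟩]
lemma chiZ_zero : chiZ 0 = 1 := by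
  rw [chiZ, if_pos ⟨0, by simp⟩]
lemma chiZ_one : chiZ 1 = 1 := by
  rw [chiZ, if_pos ⟨1, by simp⟩]
lemma chiO_zero : chiO 0 = 0 := by
  rw [chiO, if_neg]
  rintro ⟨n, h⟩
  have : (0 : ℤ) = 2 * n + 1 := by exact_mod_cast h
  omega
lemma chiE_one : chiE 1 = 0 := by
  rw [chiE, if_neg]
  rintro ⟨n, h⟩
  have : (1 : ℤ) = 2 * n := by exact_mod_cast h
  omega
lemma chiZ_mid {z : ℝ} (h0 : 0 < z) (h1 : z < 1) : chiZ z = 0 := by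
  rw [chiZ, if_neg]
  rintro ⟨n, rfl⟩
  have a : (0 : ℤ) < n := by exact_mod_cast h0
  have b : n < (1 : ℤ) := by exact_mod_cast h1
  omega
lemma chiE_mid {z : ℝ} (h0 : 0 < z) (h1 : z < 1) : chiE z = 0 := by
  rw [chiE, if_neg]
  rintro ⟨n, rfl⟩
  have a : (0 : ℤ) < 2 * n := by exact_mod_cast h0
  have b : 2 * n < (1 : ℤ) := by exact_mod_cast h1
  omega
lemma chiO_mid {z : ℝ} (h0 : 0 < z) (h1 : z < 1) : chiO z = 0 := by
  rw [chiO, if_neg]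
  rintro ⟨n, rfl⟩
  have a : (0 : ℤ) < 2 * n + 1 := by exact_mod_cast h0
  have b : 2 * n + 1 < (1 : ℤ) := by exact_mod_cast h1
  omega

/-- The factor of a positive root in `kappaW`. -/
def fac (k kr ur : Fˣ) (v c : E r) : Fˣ :=
  if ip r v v = 4 then kr ^ (chiE (ip r v c) : ℤ) * ur ^ (-(chiO (ip r v c) : ℤ))
  else k ^ ((chiE (ip r v c) : ℤ) - (chiO (ip r v c) : ℤ))

lemma Tel_lt (k kr ur : Fˣ) (i : ℕ) (h1 : 1 ≤ i) (h2 : i < r) (y : E r)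
    (hz0 : 0 ≤ ip r (srt r i) y) (hz1 : ip r (srt r i) y ≤ 1) :
    Tel F r (k : F) (kr : F) (ur : F) i y =
      ((fac F k kr ur (srt r i) y : Fˣ) : F) • X F r (sRefl r (srt r i) y) := by
  have hz : cd r y i - cd r y (i + 1) = ip r (srt r i) y := by
    rw [srt_lt i h1 h2, ip_sub, ip_eV, ip_eV, h_cd y i h1 h2.le, h_cd y (i + 1) (by omega) h2]
    rfl
  have hnorm := srt_norm_lt i h1 h2
  have hs : epsV r i - epsV r (i + 1) = srt r i := by rw [srt, if_neg h2.ne]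
  rw [Tel, if_neg h2.ne, sW_refl i h1 h2.le, nablaIel, hz, hs, fac, hnorm, if_neg (by norm_num)]
  generalize hzz : ip r (srt r i) y = z at *
  rcases hz1.lt_or_eq with hlt | rfl
  · have hf : ⌊z⌋ = 0 := by rw [Int.floor_eq_zero_iff]; exact ⟨hz0, hlt⟩
    rw [hf, neg_zero, geomS_zero, zero_mul, smul_zero, add_zero]
    rcases hz0.lt_or_eq with hgt | rfl
    · rw [chiZ_mid hgt hlt, chiE_mid hgt hlt, chiO_mid hgt hlt]; simp
    · rw [chiZ_zero, chiE_zero, chiO_zero]; simp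
  · rw [Int.floor_one, geomS_neg_one, chiZ_one, chiE_one, chiO_one, neg_mul, X_mul]
    have : -srt r i + y = sRefl r (srt r i) y := by
      rw [sRefl, coroot, hnorm, hzz]; module
    rw [this]
    simp [sub_smul]

lemma Tel_r (k kr ur : Fˣ) (h1 : 1 ≤ r) (y : E r)
    (hz0 : 0 ≤ ip r (srt r r) y) (hz1 : ip r (srt r r) y ≤ 1) :
    Tel F r (k : F) (kr : F) (ur : F) r y =
      ((fac F k kr ur (srt r r) y : Fˣ) : F) • X F r (sRefl r (srt r r) y) := by
  have hz : 2 * cd r y r = ip r (srt r r) y := by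
    rw [srt_r h1, ip_smul, ip_eV, h_cd y r h1 le_rfl]
  have hnorm := srt_norm_r h1
  have hs : (2 : ℝ) • epsV r r = srt r r := by rw [srt, if_pos rfl]
  rw [Tel, if_pos rfl, sW_refl r h1 le_rfl, nablaReEl, nablaRoEl, hz, hs, fac, hnorm, if_pos rfl]
  generalize hzz : ip r (srt r r) y = z at *
  have hE : floorE z = 0 := by
    rw [floorE, Int.floor_eq_zero_iff.2 ⟨by linarith, by linarith⟩]; rfl
  rw [hE, neg_zero, Int.zero_ediv, geomS_zero, zero_mul, smul_zero, add_zero]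
  rcases hz1.lt_or_eq with hlt | rfl
  · have hO : floorO z = -1 := by
      rw [floorO, Int.floor_eq_zero_iff.2 ⟨by linarith, by linarith⟩]; rfl
    have : (-floorO z - 1) / 2 = 0 := by rw [hO]; rfl
    rw [this, geomS_zero, mul_zero, zero_mul, smul_zero, add_zero]
    rcases hz0.lt_or_eq with hgt | rfl
    · rw [chiE_mid hgt hlt, chiO_mid hgt hlt]; simp
    · rw [chiE_zero, chiO_zero]; simp
  · have hO : floorO 1 = 1 := by
      rw [floorO]; norm_num
    have : (-floorO 1 - 1) / 2 = -1 := by rw [hO]; rfl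
    rw [this, geomS_neg_one, chiE_one, chiO_one, mul_neg, neg_mul, X_mul, X_mul]
    have : epsV r r + -srt r r + y = sRefl r (srt r r) y := by
      rw [sRefl, coroot, hnorm, hzz, ← hs]; module
    rw [this]
    simp [sub_smul]

lemma Tel_all (k kr ur : Fˣ) (i : ℕ) (h1 : 1 ≤ i) (h2 : i ≤ r) (y : E r)
    (hz0 : 0 ≤ ip r (srt r i) y) (hz1 : ip r (srt r i) y ≤ 1) :
    Tel F r (k : F) (kr : F) (ur : F) i y =
      ((fac F k kr ur (srt r i) y : Fˣ) : F) • X F r (sRefl r (srt r i) y) := by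
  rcases h2.lt_or_eq with h | h
  · exact Tel_lt F k kr ur i h1 h y hz0 hz1
  · subst h; exact Tel_r F k kr ur h1 y hz0 hz1

/-- Pairs `a < b`. -/
def pairs (r : ℕ) : Finset (Fin r × Fin r) := Finset.univ.filter fun p => p.1 < p.2

/-- The finite set of positive roots. -/
def PhiF (r : ℕ) : Finset (E r) :=
  ((pairs r).image fun p => eV r p.1 - eV r p.2) ∪
  ((pairs r).image fun p => eV r p.1 + eV r p.2) ∪
  (Finset.univ.image fun a => (2 : ℝ) • eV r a)

lemma mem_PhiF (v : E r) : v ∈ PhiF r ↔ v ∈ PhiPlus r := by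
  simp only [PhiF, pairs, Finset.mem_union, Finset.mem_image, Finset.mem_filter, Finset.mem_univ,
    true_and, PhiPlus, Set.mem_setOf_eq, Prod.exists, or_assoc]
  simp only [eq_comm]

lemma norm_diff {a b : Fin r} (h : a < b) :
    ip r (eV r a - eV r b) (eV r a - eV r b) = 2 := by
  rw [ip_sub, ip_eV, ip_eV]
  simp [eV_apply, h.ne, h.ne']; norm_num
lemma norm_sum {a b : Fin r} (h : a < b) :
    ip r (eV r a + eV r b) (eV r a + eV r b) = 2 := by
  rw [ip_add, ip_eV, ip_eV]
  simp [eV_apply, h.ne, h.ne']; norm_num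
lemma norm_long (a : Fin r) :
    ip r ((2 : ℝ) • eV r a) ((2 : ℝ) • eV r a) = 4 := by
  rw [ip_smul, ip_eV]
  simp [eV_apply]; norm_num

lemma inj_diff {a b a' b' : Fin r} (h : a < b) (h' : a' < b')
    (he : eV r a - eV r b = eV r a' - eV r b') : a = a' ∧ b = b' := by
  have e1 := congrFun he a
  have e2 := congrFun he b
  simp only [Pi.sub_apply, eV_apply, if_true, if_neg h.ne, if_neg h.ne'] at e1 e2
  constructor
  · by_contra hc
    rw [if_neg hc] at e1
    split_ifs at e1 <;> norm_num at e1
  · by_contra hc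
    rw [if_neg hc] at e2
    split_ifs at e2 <;> norm_num at e2

lemma inj_sum {a b a' b' : Fin r} (h : a < b) (h' : a' < b')
    (he : eV r a + eV r b = eV r a' + eV r b') : a = a' ∧ b = b' := by
  have e1 := congrFun he a
  have e2 := congrFun he b
  simp only [Pi.add_apply, eV_apply, if_true, if_neg h.ne, if_neg h.ne'] at e1 e2
  have c1 : a = a' ∨ a = b' := by
    by_contra hc
    push Not at hc
    rw [if_neg hc.1, if_neg hc.2] at e1
    norm_num at e1
  have c2 : b = a' ∨ b = b' := by
    by_contra hc
    push Not at hc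
    rw [if_neg hc.1, if_neg hc.2] at e2
    norm_num at e2
  simp only [Fin.ext_iff, Fin.lt_def] at *
  omega

lemma inj_long {a a' : Fin r} (he : (2 : ℝ) • eV r a = (2 : ℝ) • eV r a') : a = a' := by
  have e1 := congrFun he a
  simp only [Pi.smul_apply, eV_apply, if_true] at e1
  by_contra hc
  rw [if_neg hc] at e1
  norm_num at e1

lemma diff_ne_sum {a b a' b' : Fin r} : eV r a - eV r b ≠ eV r a' + eV r b' := by
  intro he
  have := congrArg (fun v => ip r v (fun _ => 1)) he
  simp only [ip_sub, ip_add, ip_eV] at this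
  norm_num at this

lemma prod_PhiF (f : E r → Fˣ) :
    ∏ v ∈ PhiF r, f v =
      (∏ p : Fin r × Fin r, if p.1 < p.2 then f (eV r p.1 - eV r p.2) else 1) *
      (∏ p : Fin r × Fin r, if p.1 < p.2 then f (eV r p.1 + eV r p.2) else 1) *
      ∏ a : Fin r, f ((2 : ℝ) • eV r a) := by
  rw [PhiF, Finset.prod_union, Finset.prod_union, Finset.prod_image, Finset.prod_image,
    Finset.prod_image, pairs, Finset.prod_filter, Finset.prod_filter]
  · intro a _ b _ h; exact inj_long h
  · intro p hp q hq h
    simp only [pairs, Finset.coe_filter, Finset.mem_univ, true_and, Set.mem_setOf_eq] at hp hq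
    exact Prod.ext_iff.2 (inj_sum hp hq h)
  · intro p hp q hq h
    simp only [pairs, Finset.coe_filter, Finset.mem_univ, true_and, Set.mem_setOf_eq] at hp hq
    exact Prod.ext_iff.2 (inj_diff hp hq h)
  · rw [Finset.disjoint_left]
    intro v hv hv'
    obtain ⟨p, _, rfl⟩ := Finset.mem_image.1 hv
    obtain ⟨q, _, hq⟩ := Finset.mem_image.1 hv'
    exact diff_ne_sum hq.symm
  · rw [Finset.disjoint_left]
    intro v hv hv'
    obtain ⟨q, _, hq⟩ := Finset.mem_image.1 hv'
    have n4 := norm_long q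
    rw [hq] at n4
    rcases Finset.mem_union.1 hv with hv | hv
    · obtain ⟨p, hp, rfl⟩ := Finset.mem_image.1 hv
      rw [norm_diff (Finset.mem_filter.1 hp).2] at n4
      norm_num at n4
    · obtain ⟨p, hp, rfl⟩ := Finset.mem_image.1 hv
      rw [norm_sum (Finset.mem_filter.1 hp).2] at n4
      norm_num at n4

lemma kappaW_eq (k kr ur : Fˣ) (w : E r → E r) (c : E r) :
    kappaW F r k kr ur w c =
      ∏ v ∈ (PhiF r).filter (fun v => -w v ∈ PhiPlus r), fac F k kr ur v c := by
  rw [Finset.prod_filter, prod_PhiF, kappaW]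
  congr 1
  · congr 1
    · refine Finset.prod_congr rfl fun p _ => ?_
      by_cases h : p.1 < p.2
      · simp only [h, true_and, if_true, fac, norm_diff h]
        norm_num
      · simp [h]
    · refine Finset.prod_congr rfl fun p _ => ?_
      by_cases h : p.1 < p.2
      · simp only [h, true_and, if_true, fac, norm_sum h]
        norm_num
      · simp [h]
  · refine Finset.prod_congr rfl fun a _ => ?_
    simp only [fac, norm_long a, if_true]

lemma kappaW_nil (k kr ur : Fˣ) (c : E r) :
    kappaW F r k kr ur (fun y => wordAct r [] y) c = 1 := by
  rw [kappaW_eq, Finset.filter_false_of_mem, Finset.prod_empty]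
  intro v hv
  exact not_both v ((mem_PhiF v).1 hv)

lemma kappaW_cons (k kr ur : Fˣ) (c : E r) {i : ℕ} {l : List ℕ} (hl : Val r (i :: l))
    (hred : Red r (i :: l)) :
    kappaW F r k kr ur (fun y => wordAct r (i :: l) y) c =
      fac F k kr ur (srt r i) (wordAct r l c) * kappaW F r k kr ur (fun y => wordAct r l y) c := by
  obtain ⟨h1, h2⟩ := hl i (by simp)
  have hpos := hred.pos h1 h2 hl.tail
  set b := wordAct r l.reverse (srt r i) with hb
  have hwb : wordAct r l b = srt r i := wordAct_rev' hl.tail _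
  have hfac : fac F k kr ur (srt r i) (wordAct r l c) = fac F k kr ur b c := by
    rw [fac, fac, ← hwb, wordAct_ip hl.tail, wordAct_ip hl.tail]
  rw [kappaW_eq, kappaW_eq, hfac,
    ← Finset.prod_insert (f := fun v => fac F k kr ur v c) (a := b)]
  · refine Finset.prod_congr ?_ fun _ _ => rfl
    ext v
    simp only [Finset.mem_insert, Finset.mem_filter, mem_PhiF]
    constructor
    · rintro ⟨hv, hn⟩
      by_cases hvb : v = b
      · exact Or.inl hvb
      · refine Or.inr ⟨hv, ?_⟩
        rcases wordAct_root hl.tail v hv with h | h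
        · exfalso
          have hne : wordAct r l v ≠ srt r i := by
            intro he
            apply hvb
            rw [hb, ← he, wordAct_rev hl.tail]
          rw [wordAct_cons h1 h2] at hn
          exact not_both _ (simple_perm i h1 h2 _ h hne) hn
        · exact h
    · rintro (rfl | ⟨hv, hn⟩)
      · refine ⟨hpos, ?_⟩
        rw [wordAct_cons h1 h2, hwb, sRefl_self _ (srt_norm_ne i h1 h2), neg_neg]
        exact srt_mem i h1 h2
      · refine ⟨hv, ?_⟩
        rw [wordAct_cons h1 h2, ← sRefl_neg]
        apply simple_perm i h1 h2 _ hn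
        intro he
        have : b = -v := by
          rw [hb, ← he, wordAct_neg hl.tail.rev, wordAct_rev hl.tail]
        rw [this] at hpos
        exact not_both v hv hpos
  · simp only [Finset.mem_filter, not_and]
    intro _
    rw [hwb]
    exact not_both _ (srt_mem i h1 h2)

lemma main_word (k kr ur : Fˣ) {c : E r} (hc : c ∈ CplusCl r) {l : List ℕ} (hl : Val r l)
    (hred : Red r l) :
    applyT F r (k : F) (kr : F) (ur : F) l (X F r c) =
      ((kappaW F r k kr ur (fun y => wordAct r l y) c : Fˣ) : F) • X F r (wordAct r l c) := by
  induction l with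
  | nil => rw [kappaW_nil]; simp [applyT, wordAct]
  | cons i l ih =>
    obtain ⟨h1, h2⟩ := hl i (by simp)
    have hpos := hred.pos h1 h2 hl.tail
    have hip : ip r (srt r i) (wordAct r l c) = ip r (wordAct r l.reverse (srt r i)) c := by
      rw [← wordAct_ip hl.tail (wordAct r l.reverse (srt r i)) c, wordAct_rev' hl.tail]
    obtain ⟨hz0, hz1⟩ := alcove_bound hc hpos
    rw [← hip] at hz0 hz1
    show Top F r (k : F) (kr : F) (ur : F) i (applyT F r (k : F) (kr : F) (ur : F) l (X F r c)) = _
    rw [ih hl.tail (hred.tail h1 h2), map_smul, Top, mkOp_X,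
      Tel_all F k kr ur i h1 h2 _ hz0 hz1, kappaW_cons F k kr ur c hl hred, wordAct_cons h1 h2,
      smul_smul, Units.val_mul, mul_comm]

end Helpers

/-- For `w ∈ W₀` with reduced expression `w = s_{i₁}⋯s_{i_ℓ}` and
`λ ∈ ℤ^r`, one has `x^λ · T_{i₁}(⋯(T_{i_ℓ}(x^{c^𝒪}))⋯) = κ_w^𝒪 · x^{λ + w c^𝒪}`;
in particular, the left-hand side does not depend on the reduced expression. -/
theorem statement10 (F : Type*) [Field F] [CharZero F] (r : ℕ) (hr : 2 ≤ r)
    (k kr ur : Fˣ) (O : Set (E r)) (hO : IsOrbit r O)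
    (l : List ℕ) (hl : ∀ a ∈ l, 1 ≤ a ∧ a ≤ r)
    (hred : l.length = w0len r (fun y => wordAct r l y)) (lam : Fin r → ℤ) :
    (X F r (zc r lam) * applyT F r (k : F) (kr : F) (ur : F) l (X F r (cpt r O))
      = ((kappaW F r k kr ur (fun y => wordAct r l y) (cpt r O) : Fˣ) : F) •
          X F r (zc r lam + wordAct r l (cpt r O))) ∧
    (∀ l' : List ℕ, (∀ a ∈ l', 1 ≤ a ∧ a ≤ r) →
      l'.length = w0len r (fun y => wordAct r l' y) →
      (fun y => wordAct r l' y) = (fun y => wordAct r l y) →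
      applyT F r (k : F) (kr : F) (ur : F) l' (X F r (cpt r O))
        = applyT F r (k : F) (kr : F) (ur : F) l (X F r (cpt r O))) := by
  have hmain := main_word F k kr ur (cpt_mem O) hl (Red.of_len hred)
  refine ⟨?_, ?_⟩
  · rw [hmain, mul_smul_comm, X_mul]
  · intro l' hl' hred' hact
    rw [hmain, main_word F k kr ur (cpt_mem O) hl' (Red.of_len hred'), hact, congrFun hact (cpt r O)]

end QP

end
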